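/- arXiv:2011.13304 — 4 statements merged into one kernel-verified Lean document; each statement's English description precedes it below -/
import Mathlib

section
/- Let k ≥ 1 and let f : ℝ^m → ℝ^n be k times continuously differentiable with Lipschitz continuous k-th derivative d^k f, and let g be a function from ℝ^m to the space of continuous (k+1)-multilinear maps (ℝ^m)^{k+1} → ℝ^n such that for almost every y ∈ ℝ^m the map d^k f is differentiable at y with derivative g(y). Let x ∈ ℝ^m be a point such that: (i) d^k f is differentiable at x with derivative g(x); (ii) for every pair u, v of distinct standard basis vectors of ℝ^m, for almost every (s,t) ∈ ℝ², d^k f is differentiable at x + su + tv with derivative g(x + su + tv); and (iii) x is a 2-Lebesgue point of g. Then g(x) is a symmetric (k+1)-multilinear map, i.e. invariant under all permutations of its k+1 arguments. -/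
open MeasureTheory Filter Set

theorem symm_aux {E F : Type*} [NormedAddCommGroup E] [NormedSpace ℝ E]
    [NormedAddCommGroup F] [NormedSpace ℝ F] (f : E → F) (k : ℕ) :
    ∀ (_ : ContDiff ℝ k f) (x : E)
      (G : ContinuousMultilinearMap ℝ (fun _ : Fin (k + 1) => E) F)
      (_ : HasFDerivAt (iteratedFDeriv ℝ k f) G.curryLeft x)
      (σ : Equiv.Perm (Fin (k + 1))) (v : Fin (k + 1) → E), G (v ∘ σ) = G v := by
  induction k with
  | zero =>
    intro _ x G _ σ v
    congr 1
    funext i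
    exact congrArg v (Subsingleton.elim (α := Fin 1) _ _)
  | succ k ih =>
    intro hf x G hG
    have hd : ∀ y, HasFDerivAt (iteratedFDeriv ℝ k f)
        (iteratedFDeriv ℝ (k + 1) f y).curryLeft y := fun y =>
      ((hf.differentiable_iteratedFDeriv (m := k)
        (by exact_mod_cast Nat.lt_succ_self k)) y).hasFDerivAt
    have hsym := fun y => ih (hf.of_le (by exact_mod_cast Nat.le_succ k)) y _ (hd y)
    -- symmetry in the last arguments
    have h1 : ∀ (τ : Equiv.Perm (Fin (k + 1))) (a : E) (w : Fin (k + 1) → E),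
        G (Fin.cons a (w ∘ τ)) = G (Fin.cons a w) := by
      intro τ a w
      have e : ∀ w : Fin (k + 1) → E, HasFDerivAt (fun y => iteratedFDeriv ℝ (k + 1) f y w)
          ((ContinuousMultilinearMap.apply ℝ (fun _ : Fin (k + 1) => E) F w).comp
            G.curryLeft) x := fun w =>
        (ContinuousMultilinearMap.apply ℝ (fun _ : Fin (k + 1) => E) F w).hasFDerivAt.comp x hG
      have e1 := e (w ∘ τ)
      simp only [hsym] at e1
      exact DFunLike.congr_fun (e1.unique (e w)) a
    -- symmetry in the first two
    have h2 : ∀ (a b : E) (w : Fin k → E),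
        G (Fin.cons a (Fin.cons b w : Fin (k + 1) → E))
          = G (Fin.cons b (Fin.cons a w : Fin (k + 1) → E)) := by
      intro a b w
      let C : ContinuousMultilinearMap ℝ (fun _ : Fin (k + 1) => E) F →L[ℝ]
          (E →L[ℝ] ContinuousMultilinearMap ℝ (fun _ : Fin k => E) F) :=
        (continuousMultilinearCurryLeftEquiv ℝ
          (fun _ : Fin (k + 1) => E) F).toContinuousLinearEquiv.toContinuousLinearMap
      have e : HasFDerivAt (fun y => (iteratedFDeriv ℝ (k + 1) f y).curryLeft)
          (C.comp G.curryLeft) x := by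
        have h0 : HasFDerivAt C C (iteratedFDeriv ℝ (k + 1) f x) := C.hasFDerivAt
        exact HasFDerivAt.comp (g := C) x h0 hG
      exact DFunLike.congr_fun (second_derivative_symmetric hd e a b) w
    have key : ∀ σ : Equiv.Perm (Fin (k + 1 + 1)),
        σ ∈ Submonoid.closure (Set.range fun i : Fin (k + 1) ↦
          Equiv.swap i.castSucc i.succ) → ∀ v, G (v ∘ σ) = G v := by
      intro σ hσ
      induction hσ using Submonoid.closure_induction with
      | one => intro v; rfl
      | mul a b _ _ ha hb =>
        intro v
        rw [Equiv.Perm.coe_mul, ← Function.comp_assoc, hb, ha]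
      | mem s hs =>
        obtain ⟨i, rfl⟩ := hs
        intro v
        induction i using Fin.cases with
        | zero =>
          have := h2 (v 1) (v 0) (fun i => v i.succ.succ)
          convert this using 2
          · funext j
            refine Fin.cases ?_ (fun j => Fin.cases ?_ (fun j => ?_) j) j
            · simp
            · simp
            · simp [Equiv.swap_apply_of_ne_of_ne, Fin.ext_iff]
          · funext j
            refine Fin.cases ?_ (fun j => Fin.cases ?_ (fun j => ?_) j) j <;> simp
        | succ i =>
          have := h1 (Equiv.swap i.castSucc i.succ) (v 0) (fun i => v i.succ)
          convert this using 2
          · funext j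
            refine Fin.cases ?_ (fun j => ?_) j
            · simp [Equiv.swap_apply_of_ne_of_ne, Fin.ext_iff]
            · simp only [Function.comp, Fin.cons_succ]
              rw [← (Fin.succ_injective _).swap_apply]
              rfl
          · funext j
            refine Fin.cases ?_ (fun j => ?_) j <;> simp
    intro σ
    exact key σ (by rw [Equiv.Perm.mclosure_swap_castSucc_succ]; trivial)

/-- Let `k ≥ 1` and `f : ℝ^m → ℝ^n` be `k` times continuously differentiable with
Lipschitz `k`-th derivative, and let `g` take values in `(k+1)`-multilinear maps with
`d^k f` a.e. differentiable with derivative `g(y)`. If `x` is a point where (i) `d^k f`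
is differentiable with derivative `g(x)`, (ii) for each pair of distinct standard
basis vectors, for a.e. `(s,t)`, `d^k f` is differentiable at `x+su+tv` with
derivative `g(x+su+tv)`, and (iii) `x` is a 2-Lebesgue point of `g`, then `g(x)` is a
symmetric `(k+1)`-multilinear map. -/
theorem higher_derivative_symmetric_at_lebesgue_point
    {m n : ℕ} (k : ℕ) (hk : 1 ≤ k)
    (f : EuclideanSpace ℝ (Fin m) → EuclideanSpace ℝ (Fin n))
    (hf : ContDiff ℝ k f)
    (L : NNReal) (hlip : LipschitzWith L (iteratedFDeriv ℝ k f))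
    (g : EuclideanSpace ℝ (Fin m) →
      ContinuousMultilinearMap ℝ (fun _ : Fin (k + 1) => EuclideanSpace ℝ (Fin m))
        (EuclideanSpace ℝ (Fin n)))
    (hg : ∀ᵐ y ∂(volume : Measure (EuclideanSpace ℝ (Fin m))),
      HasFDerivAt (iteratedFDeriv ℝ k f) (g y).curryLeft y)
    (x : EuclideanSpace ℝ (Fin m))
    (hx1 : HasFDerivAt (iteratedFDeriv ℝ k f) (g x).curryLeft x)
    (hx2 : ∀ i j : Fin m, i ≠ j →
      ∀ᵐ p : ℝ × ℝ,
        HasFDerivAt (iteratedFDeriv ℝ k f)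
          (g (x + p.1 • EuclideanSpace.single i (1 : ℝ)
              + p.2 • EuclideanSpace.single j (1 : ℝ))).curryLeft
          (x + p.1 • EuclideanSpace.single i (1 : ℝ)
              + p.2 • EuclideanSpace.single j (1 : ℝ)))
    (hx3 : ∀ i j : Fin m, i ≠ j →
      Tendsto (fun r : ℝ => (1 / r ^ 2) *
          ∫ s in (0 : ℝ)..r, ∫ t in (0 : ℝ)..r,
            ‖g (x + s • EuclideanSpace.single i (1 : ℝ)
                + t • EuclideanSpace.single j (1 : ℝ)) - g x‖)
        (nhdsWithin 0 (Ioi 0)) (nhds 0)) :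
    ∀ (σ : Equiv.Perm (Fin (k + 1))) (v : Fin (k + 1) → EuclideanSpace ℝ (Fin m)),
      g x (v ∘ σ) = g x v := by
  exact symm_aux f k hf x (g x) hx1
end

section
/- Let g : ℝ^m → ℝ^n be a locally integrable map. Then almost every point x ∈ ℝ^m is a 2-Lebesgue point of g. -/
open MeasureTheory Filter Set

section aux

variable {E F : Type*} [NormedAddCommGroup E] [NormedSpace ℝ E] [MeasurableSpace E] [BorelSpace E]
  [FiniteDimensional ℝ E] (μ : Measure E) [μ.IsAddHaarMeasure] [NormedAddCommGroup F]
  (A : ℝ × ℝ →L[ℝ] E)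

theorem aux_null (P : E → Prop) (hP : ∀ᵐ x ∂μ, P x) :
    ∀ᵐ x ∂μ, ∀ᵐ p : ℝ × ℝ, P (x + A p) := by
  obtain ⟨N, hN, hNm, hN0⟩ := exists_measurable_superset_of_null hP
  have h1 : ∀ᵐ x ∂μ, ∀ᵐ p : ℝ × ℝ, x + A p ∉ N := by
    rw [Measure.ae_ae_comm]
    · refine Eventually.of_forall fun p => ?_
      have := (measurePreserving_add_right μ (A p)).quasiMeasurePreserving.ae
        (measure_eq_zero_iff_ae_notMem.1 hN0)
      exact this
    · have : Measurable (fun x : E × (ℝ × ℝ) => x.1 + A x.2) := by fun_prop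
      exact this hNm.compl
  filter_upwards [h1] with x hx
  filter_upwards [hx] with p hp
  by_contra hc
  exact hp (hN hc)

theorem aux_null_conv (P : E → Prop) (hPm : MeasurableSet {x | P x})
    (hP : ∀ᵐ x ∂μ, ∀ᵐ p : ℝ × ℝ, P (x + A p)) : ∀ᵐ x ∂μ, P x := by
  rw [Measure.ae_ae_comm] at hP
  · obtain ⟨p, hp⟩ := hP.exists
    have := (measurePreserving_add_right μ (-A p)).quasiMeasurePreserving.ae hp
    simpa using this
  · have : Measurable (fun x : E × (ℝ × ℝ) => x.1 + A x.2) := by fun_prop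
    exact this hPm

theorem aux_locInt (h : E → F) (hm : StronglyMeasurable h) (hl : LocallyIntegrable h μ) :
    ∀ᵐ x ∂μ, LocallyIntegrable (fun p : ℝ × ℝ => h (x + A p)) := by
  have hmeas : Measurable (fun z : E × (ℝ × ℝ) => ‖h (z.1 + A z.2)‖ₑ) := by
    have : Measurable (fun x : E × (ℝ × ℝ) => x.1 + A x.2) := by fun_prop
    exact hm.enorm.comp this
  have key : ∀ n K : ℕ, ∀ᵐ x ∂μ, x ∈ Metric.closedBall (0 : E) K →
      ∫⁻ p in Metric.closedBall (0 : ℝ × ℝ) n, ‖h (x + A p)‖ₑ < ⊤ := by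
    intro n K
    rw [← ae_restrict_iff' measurableSet_closedBall]
    refine ae_lt_top (Measurable.lintegral_prod_right' hmeas) ?_
    rw [lintegral_lintegral_swap hmeas.aemeasurable]
    set R : ℝ := K + ‖A‖ * n
    have hfin : ∫⁻ y in Metric.closedBall (0 : E) R, ‖h y‖ₑ ∂μ < ⊤ :=
      (hl.integrableOn_isCompact (isCompact_closedBall _ _)).2
    have hb : ∀ p ∈ Metric.closedBall (0 : ℝ × ℝ) n,
        ∫⁻ x in Metric.closedBall (0 : E) K, ‖h (x + A p)‖ₑ ∂μ
          ≤ ∫⁻ y in Metric.closedBall (0 : E) R, ‖h y‖ₑ ∂μ := by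
      intro p hp
      rw [← (measurePreserving_add_right μ (A p)).setLIntegral_comp_preimage_emb
        (MeasurableEquiv.addRight (A p)).measurableEmbedding (fun y => ‖h y‖ₑ) (Metric.closedBall 0 R)]
      refine lintegral_mono_set fun x hx => ?_
      simp only [mem_preimage, mem_closedBall_zero_iff] at hx hp ⊢
      calc ‖x + A p‖ ≤ ‖x‖ + ‖A p‖ := norm_add_le _ _
        _ ≤ K + ‖A‖ * n := by
          gcongr
          exact (A.le_opNorm p).trans (by gcongr)
    refine ne_top_of_le_ne_top ?_ (setLIntegral_mono' measurableSet_closedBall hb)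
    rw [setLIntegral_const]
    exact ENNReal.mul_ne_top hfin.ne measure_closedBall_lt_top.ne
  have key2 : ∀ᵐ x ∂μ, ∀ n K : ℕ, x ∈ Metric.closedBall (0 : E) K →
      ∫⁻ p in Metric.closedBall (0 : ℝ × ℝ) n, ‖h (x + A p)‖ₑ < ⊤ :=
    ae_all_iff.2 fun n => ae_all_iff.2 fun K => key n K
  filter_upwards [key2] with x hx
  rw [locallyIntegrable_iff]
  intro k hk
  obtain ⟨r, hr⟩ := hk.isBounded.subset_closedBall 0
  obtain ⟨n, hn⟩ := exists_nat_ge r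
  obtain ⟨K, hK⟩ := exists_nat_ge ‖x‖
  have hsub : k ⊆ Metric.closedBall (0 : ℝ × ℝ) n := hr.trans (Metric.closedBall_subset_closedBall hn)
  refine IntegrableOn.mono_set ⟨?_, hx n K (by simpa using hK)⟩ hsub
  have : Measurable (fun p : ℝ × ℝ => x + A p) := by fun_prop
  exact (hm.comp_measurable this).aestronglyMeasurable

theorem aux_good (h : E → F) (hm : StronglyMeasurable h) (hl : LocallyIntegrable h μ) :
    ∀ᵐ x ∂μ, Tendsto (fun k : ℕ => (k : ENNReal) ^ 2 *
      ∫⁻ q in Metric.closedBall (0 : ℝ × ℝ) (k : ℝ)⁻¹, ‖h (x + A q) - h x‖ₑ) atTop (nhds 0) := by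
  refine aux_null_conv μ A _ ?_ ?_
  · refine measurableSet_tendsto _ fun k => ?_
    refine Measurable.const_mul ?_ _
    have h1 : Measurable (fun x : E × (ℝ × ℝ) => x.1 + A x.2) := by fun_prop
    have h2 : Measurable (fun z : E × (ℝ × ℝ) => ‖h (z.1 + A z.2) - h z.1‖ₑ) :=
      ((hm.comp_measurable h1).sub (hm.comp_measurable measurable_fst)).enorm
    exact Measurable.lintegral_prod_right' h2
  · filter_upwards [aux_locInt μ A h hm hl] with x hx
    filter_upwards [(Besicovitch.vitaliFamily
      (volume : Measure (ℝ × ℝ))).ae_tendsto_lintegral_enorm_sub_div hx] with p hp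
    have h1 := hp.comp (Besicovitch.tendsto_filterAt (volume : Measure (ℝ × ℝ)) p)
    have hk : Tendsto (fun k : ℕ => (k : ℝ)⁻¹) atTop (nhdsWithin 0 (Ioi 0)) :=
      tendsto_inv_atTop_nhdsGT_zero.comp tendsto_natCast_atTop_atTop
    have h2 := ENNReal.Tendsto.const_mul (a := 4) (h1.comp hk) (Or.inr (by simp))
    rw [mul_zero] at h2
    refine h2.congr' ?_
    filter_upwards [eventually_ge_atTop 1] with k hk1
    have hk0 : (k : ENNReal) ≠ 0 := by
      simp only [ne_eq, Nat.cast_eq_zero]; omega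
    have hvol : (volume : Measure (ℝ × ℝ)) (Metric.closedBall p (k : ℝ)⁻¹)
        = 4 * ((k : ENNReal) ^ 2)⁻¹ := by
      rw [← Prod.mk.eta (p := p), ← closedBall_prod_same, Measure.volume_eq_prod,
        Measure.prod_prod, Real.volume_closedBall, Real.volume_closedBall,
        ENNReal.ofReal_mul (by norm_num), ENNReal.ofReal_inv_of_pos (by positivity),
        ENNReal.ofReal_natCast, ENNReal.inv_pow]
      norm_num
      ring
    have hint : ∫⁻ q in Metric.closedBall (0 : ℝ × ℝ) (k : ℝ)⁻¹, ‖h (x + A p + A q) - h (x + A p)‖ₑ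
        = ∫⁻ y in Metric.closedBall p (k : ℝ)⁻¹, ‖h (x + A y) - h (x + A p)‖ₑ := by
      rw [← (measurePreserving_add_left volume p).setLIntegral_comp_preimage_emb
        (MeasurableEquiv.addLeft p).measurableEmbedding
        (fun y => ‖h (x + A y) - h (x + A p)‖ₑ) (Metric.closedBall p (k : ℝ)⁻¹)]
      simp [add_assoc]
    simp only [Function.comp]
    rw [hint, hvol, ENNReal.div_eq_inv_mul, ENNReal.mul_inv (by simp) (by simp), inv_inv,
      ← mul_assoc, ← mul_assoc, ENNReal.mul_inv_cancel (by simp) (by simp), one_mul]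

theorem aux_main (g : E → F) (hl : LocallyIntegrable g μ) :
    ∀ᵐ x ∂μ, Tendsto (fun r : ℝ => (1 / r ^ 2) *
            ∫ s in (0 : ℝ)..r, ∫ t in (0 : ℝ)..r, ‖g (x + A (s, t)) - g x‖)
          (nhdsWithin 0 (Ioi 0)) (nhds 0) := by
  obtain ⟨h, hm, hgh⟩ := hl.aestronglyMeasurable
  have hlh : LocallyIntegrable h μ := hl.congr hgh
  filter_upwards [hgh, aux_null μ A _ hgh, aux_good μ A h hm hlh] with x hx1 hx2 hx3
  have hf : Tendsto (fun r : ℝ => ⌊r⁻¹⌋₊) (nhdsWithin 0 (Ioi 0)) atTop :=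
    tendsto_nat_floor_atTop.comp tendsto_inv_nhdsGT_zero
  have h4 := ENNReal.Tendsto.const_mul (a := 4) (hx3.comp hf) (Or.inr (by simp))
  rw [mul_zero] at h4
  rw [tendsto_zero_iff_enorm_tendsto_zero]
  refine tendsto_of_tendsto_of_tendsto_of_le_of_le' tendsto_const_nhds h4
    (Eventually.of_forall fun _ => zero_le) ?_
  filter_upwards [self_mem_nhdsWithin, hf.eventually_ge_atTop 1] with r hr hk
  have hr : 0 < r := hr
  simp only [Function.comp]
  set k := ⌊r⁻¹⌋₊ with hkdef
  have hk1 : (1 : ℝ) ≤ k := by exact_mod_cast hk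
  have hkr : (k : ℝ) ≤ r⁻¹ := Nat.floor_le (by positivity)
  have hkr' : r⁻¹ < k + 1 := Nat.lt_floor_add_one _
  have hrk : r ≤ (k : ℝ)⁻¹ := by
    rw [le_inv_comm₀ hr (by linarith)]; exact hkr
  rw [enorm_mul, ← mul_assoc]
  refine mul_le_mul' ?_ ?_
  · rw [Real.enorm_of_nonneg (by positivity)]
    have : (4 : ENNReal) * (k : ENNReal) ^ 2 = ENNReal.ofReal (4 * (k : ℝ) ^ 2) := by
      rw [ENNReal.ofReal_mul (by norm_num), ENNReal.ofReal_pow (by positivity),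
        ENNReal.ofReal_natCast]
      norm_num
    rw [this]
    refine ENNReal.ofReal_le_ofReal ?_
    have h0 : 0 < r⁻¹ := by positivity
    have : 1 / r ^ 2 = r⁻¹ ^ 2 := by simp
    rw [this]
    nlinarith
  · have hmp : Measurable (fun p : ℝ × ℝ => ‖h (x + A p) - h x‖ₑ) := by
      have : Measurable (fun p : ℝ × ℝ => x + A p) := by fun_prop
      exact ((hm.comp_measurable this).sub stronglyMeasurable_const).enorm
    have hae : ∀ᵐ s : ℝ, ∀ᵐ t : ℝ, g (x + A (s, t)) = h (x + A (s, t)) :=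
      Measure.ae_ae_of_ae_prod hx2
    rw [intervalIntegral.integral_of_le hr.le]
    calc _ ≤ ∫⁻ s in Ioc 0 r, ‖∫ t in (0 : ℝ)..r, ‖g (x + A (s, t)) - g x‖‖ₑ :=
          enorm_integral_le_lintegral_enorm _
      _ ≤ ∫⁻ s in Ioc 0 r, ∫⁻ t in Ioc 0 r, ‖h (x + A (s, t)) - h x‖ₑ := by
          refine lintegral_mono_ae ?_
          filter_upwards [ae_restrict_of_ae hae] with s hs
          rw [intervalIntegral.integral_of_le hr.le]
          refine (enorm_integral_le_lintegral_enorm _).trans ?_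
          refine lintegral_mono_ae ?_
          filter_upwards [ae_restrict_of_ae hs] with t ht
          rw [ht, hx1, enorm_norm]
      _ = ∫⁻ p in Ioc 0 r ×ˢ Ioc 0 r, ‖h (x + A p) - h x‖ₑ := by
          rw [Measure.volume_eq_prod, ← Measure.prod_restrict, lintegral_prod _ hmp.aemeasurable]
      _ ≤ _ := by
          refine lintegral_mono_set ?_
          rintro ⟨a, b⟩ ⟨ha, hb⟩
          simp only [mem_Ioc] at ha hb
          rw [mem_closedBall_zero_iff, Prod.norm_def]
          simp only [Real.norm_eq_abs]
          rw [abs_of_pos ha.1, abs_of_pos hb.1]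
          exact max_le (ha.2.trans hrk) (hb.2.trans hrk)

end aux

/-- Almost every point of `ℝ^m` is a 2-Lebesgue point of a locally integrable map
`g : ℝ^m → ℝ^n`: for a.e. `x`, for every pair of distinct standard basis vectors
`u, v`, `(1/r²) ∫₀^r ∫₀^r ‖g(x+su+tv) − g(x)‖ ds dt → 0` as `r → 0⁺`. -/
theorem ae_two_lebesgue_point
    {m n : ℕ} (g : EuclideanSpace ℝ (Fin m) → EuclideanSpace ℝ (Fin n))
    (hg : LocallyIntegrable g (volume : Measure (EuclideanSpace ℝ (Fin m)))) :
    ∀ᵐ x ∂(volume : Measure (EuclideanSpace ℝ (Fin m))),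
      ∀ i j : Fin m, i ≠ j →
        Tendsto (fun r : ℝ => (1 / r ^ 2) *
            ∫ s in (0 : ℝ)..r, ∫ t in (0 : ℝ)..r,
              ‖g (x + s • EuclideanSpace.single i (1 : ℝ)
                  + t • EuclideanSpace.single j (1 : ℝ)) - g x‖)
          (nhdsWithin 0 (Ioi 0)) (nhds 0) := by
  refine ae_all_iff.2 fun i => ae_all_iff.2 fun j => ?_
  have := aux_main volume
    ((ContinuousLinearMap.fst ℝ ℝ ℝ).smulRight (EuclideanSpace.single i (1 : ℝ))
      + (ContinuousLinearMap.snd ℝ ℝ ℝ).smulRight (EuclideanSpace.single j (1 : ℝ))) g hg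
  filter_upwards [this] with x hx _
  simpa only [ContinuousLinearMap.add_apply, ContinuousLinearMap.smulRight_apply,
    ContinuousLinearMap.coe_fst', ContinuousLinearMap.coe_snd', ← add_assoc] using hx
end

section
/- Let f : ℝ^m → ℝ^n be differentiable with Lipschitz continuous derivative df, and let g : ℝ^m → L(ℝ^m, L(ℝ^m, ℝ^n)) be a function such that for almost every y ∈ ℝ^m the map df is differentiable at y with derivative g(y). Let x, u, v ∈ ℝ^m and r > 0, and assume that for almost every (s,t) ∈ (0,r)², df is differentiable at x + su + tv with derivative g(x + su + tv). Then f(x + ru + rv) − f(x + ru) − f(x + rv) + f(x) = ∫₀^r ∫₀^r g(x + su + tv)(u)(v) ds dt. -/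
open MeasureTheory Filter Set

theorem lip_ftc_aux {n : ℕ} (φ φ' : ℝ → EuclideanSpace ℝ (Fin n)) (K : NNReal)
    (hφ : LipschitzWith K φ) (r : ℝ) (hr : 0 < r)
    (h : ∀ᵐ t : ℝ, t ∈ Ioo (0 : ℝ) r → HasDerivAt φ (φ' t) t) :
    ∫ t in (0 : ℝ)..r, φ' t = φ r - φ 0 := by
  have hne : ∀ᵐ t : ℝ, t ≠ r := by
    simp [ae_iff, measure_singleton]
  have h1 : ∫ t in (0 : ℝ)..r, φ' t = ∫ t in (0 : ℝ)..r, deriv φ t := by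
    apply intervalIntegral.integral_congr_ae
    filter_upwards [h, hne] with t ht htr hmem
    rw [uIoc_of_le hr.le] at hmem
    exact (ht ⟨hmem.1, lt_of_le_of_ne hmem.2 htr⟩).deriv.symm
  have hint : IntervalIntegrable (deriv φ) volume 0 r := by
    apply (intervalIntegrable_const (c := (K : ℝ))).mono_fun
    · exact (stronglyMeasurable_deriv φ).aestronglyMeasurable
    · refine Eventually.of_forall fun t => ?_
      simpa using norm_deriv_le_of_lipschitz hφ
  rw [h1]
  ext i
  have hc := (EuclideanSpace.proj i : EuclideanSpace ℝ (Fin n) →L[ℝ] ℝ).intervalIntegral_comp_comm hint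
  have hl : LipschitzWith (1 * K) (fun t => φ t i) :=
    (LipschitzWith.of_dist_le_mul (K := 1) (f := fun y : EuclideanSpace ℝ (Fin n) => y i)
      (fun a b => by
        rw [dist_eq_norm, dist_eq_norm]
        simpa using PiLp.norm_apply_le (a - b) i)).comp hφ
  have hf := ((hl.lipschitzOnWith (s := uIcc 0 r)).absolutelyContinuousOnInterval).integral_deriv_eq_sub
  simp only [PiLp.sub_apply]
  rw [← hf]
  refine Eq.trans hc.symm ?_
  apply intervalIntegral.integral_congr_ae
  filter_upwards [h, hne] with t ht htr hmem
  rw [uIoc_of_le hr.le] at hmem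
  have hd := ht ⟨hmem.1, lt_of_le_of_ne hmem.2 htr⟩
  have := ((EuclideanSpace.proj i : EuclideanSpace ℝ (Fin n) →L[ℝ] ℝ).hasFDerivAt.comp_hasDerivAt t hd)
  rw [hd.deriv]
  exact this.deriv.symm

/-- Let `f : ℝ^m → ℝ^n` be differentiable with Lipschitz derivative `f'`, and let `g`
be such that a.e. `f'` is differentiable with derivative `g(y)`. If for a.e.
`(s,t) ∈ (0,r)²` the derivative of `f'` at `x+su+tv` is `g(x+su+tv)`, then
`f(x+ru+rv) − f(x+ru) − f(x+rv) + f(x) = ∫₀^r ∫₀^r g(x+su+tv)(u)(v) ds dt`. -/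
theorem second_difference_eq_double_integral
    {m n : ℕ}
    (f : EuclideanSpace ℝ (Fin m) → EuclideanSpace ℝ (Fin n))
    (f' : EuclideanSpace ℝ (Fin m) →
      (EuclideanSpace ℝ (Fin m) →L[ℝ] EuclideanSpace ℝ (Fin n)))
    (hf : ∀ y, HasFDerivAt f (f' y) y)
    (L : NNReal) (hlip : LipschitzWith L f')
    (g : EuclideanSpace ℝ (Fin m) →
      (EuclideanSpace ℝ (Fin m) →L[ℝ]
        EuclideanSpace ℝ (Fin m) →L[ℝ] EuclideanSpace ℝ (Fin n)))
    (hg : ∀ᵐ y ∂(volume : Measure (EuclideanSpace ℝ (Fin m))),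
      HasFDerivAt f' (g y) y)
    (x u v : EuclideanSpace ℝ (Fin m)) (r : ℝ) (hr : 0 < r)
    (hae : ∀ᵐ p : ℝ × ℝ, p ∈ Ioo (0 : ℝ) r ×ˢ Ioo (0 : ℝ) r →
      HasFDerivAt f' (g (x + p.1 • u + p.2 • v)) (x + p.1 • u + p.2 • v)) :
    f (x + r • u + r • v) - f (x + r • u) - f (x + r • v) + f x
      = ∫ s in (0 : ℝ)..r, ∫ t in (0 : ℝ)..r, g (x + s • u + t • v) u v := by
  have hae' : ∀ᵐ s : ℝ, ∀ᵐ t : ℝ, (s, t) ∈ Ioo (0 : ℝ) r ×ˢ Ioo (0 : ℝ) r →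
      HasFDerivAt f' (g (x + s • u + t • v)) (x + s • u + t • v) :=
    Measure.ae_ae_of_ae_prod hae
  have hne : ∀ᵐ t : ℝ, t ≠ r := by
    simp [ae_iff, measure_singleton]
  have hcont : Continuous f' := hlip.continuous
  have key : ∫ s in (0 : ℝ)..r, ∫ t in (0 : ℝ)..r, g (x + s • u + t • v) u v
      = ∫ s in (0 : ℝ)..r, (f' (x + s • u + r • v) u - f' (x + s • u) u) := by
    apply intervalIntegral.integral_congr_ae
    filter_upwards [hae', hne] with s hs hsr hmem
    rw [uIoc_of_le hr.le] at hmem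
    have hs0 : s ∈ Ioo (0 : ℝ) r := ⟨hmem.1, lt_of_le_of_ne hmem.2 hsr⟩
    have hline : LipschitzWith ‖v‖₊ (fun t : ℝ => x + s • u + t • v) :=
      LipschitzWith.of_dist_le_mul fun a b => by
        rw [dist_eq_norm, dist_eq_norm, add_sub_add_left_eq_sub, ← sub_smul, norm_smul, mul_comm]
        rfl
    have hev : LipschitzWith ‖u‖₊ (fun A : EuclideanSpace ℝ (Fin m) →L[ℝ] EuclideanSpace ℝ (Fin n) => A u) :=
      LipschitzWith.of_dist_le_mul fun A B => by
        rw [dist_eq_norm, dist_eq_norm, ← ContinuousLinearMap.sub_apply, mul_comm]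
        exact (A - B).le_opNorm u
    have := lip_ftc_aux (fun t => f' (x + s • u + t • v) u)
      (fun t => g (x + s • u + t • v) u v) _ (hev.comp (hlip.comp hline)) r hr (by
        filter_upwards [hs] with t ht htm
        have hd := ht ⟨hs0, htm⟩
        have hl : HasDerivAt (fun t : ℝ => x + s • u + t • v) v t := by
          simpa using ((hasDerivAt_id t).smul_const v).const_add (x + s • u)
        rw [second_derivative_symmetric hf hd u v]
        have h2 := hd.comp_hasDerivAt t hl
        simpa using h2.clm_apply (hasDerivAt_const t u))
    simpa using this
  rw [key]
  have hD : ∀ (c : EuclideanSpace ℝ (Fin m)) (s : ℝ),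
      HasDerivAt (fun s : ℝ => f (x + s • u + c)) (f' (x + s • u + c) u) s := by
    intro c s
    have hl : HasDerivAt (fun s : ℝ => x + s • u + c) u s := by
      simpa using (((hasDerivAt_id s).smul_const u).const_add x).add_const c
    exact (hf _).comp_hasDerivAt s hl
  have := intervalIntegral.integral_eq_sub_of_hasDerivAt (a := 0) (b := r)
    (f := fun s : ℝ => f (x + s • u + r • v) - f (x + s • u))
    (f' := fun s => f' (x + s • u + r • v) u - f' (x + s • u) u)
    (fun s _ => (hD (r • v) s).sub (by simpa using hD 0 s))
    (Continuous.intervalIntegrable (by fun_prop) _ _)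
  rw [this]
  simp only [zero_smul, add_zero]
  abel
end

section
/- Let K be a compact topological space, t₀ ∈ ℝ, and c > 0. Let s : [t₀,∞) × K → ℝ be continuous, such that for each v ∈ K the function t ↦ s(t,v) is differentiable and the partial derivative ∂s/∂t is continuous on [t₀,∞) × K. Assume that whenever t ≥ t₀ and v ∈ K satisfy s(t,v) = max_{w ∈ K} s(t,w) > 0, one has ∂s/∂t(t,v) ≤ −c·s(t,v). Then the function s₊(t) := max(0, max_{w ∈ K} s(t,w)) satisfies s₊(t) ≤ e^{−c(t−t₀)}·s₊(t₀) for all t ≥ t₀. -/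
open Set

/-- Let `K` be a compact space, `t₀ ∈ ℝ`, `c > 0`, and `s : [t₀,∞) × K → ℝ` continuous,
differentiable in `t` with continuous partial derivative `s'`. If whenever `s(t,v)`
equals the (positive) maximum `max_{w} s(t,w) > 0` one has `s'(t,v) ≤ −c s(t,v)`, then
`s₊(t) = max(0, max_w s(t,w))` satisfies `s₊(t) ≤ e^{−c(t−t₀)} s₊(t₀)` for `t ≥ t₀`. -/
theorem max_decay_of_derivative_bound
    {K : Type*} [TopologicalSpace K] [CompactSpace K] [Nonempty K]
    (t₀ c : ℝ) (hc : 0 < c) (s s' : ℝ × K → ℝ)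
    (hs : ContinuousOn s (Ici t₀ ×ˢ (univ : Set K)))
    (hds : ∀ (v : K) (t : ℝ), t₀ ≤ t →
      HasDerivWithinAt (fun τ : ℝ => s (τ, v)) (s' (t, v)) (Ici t₀) t)
    (hs' : ContinuousOn s' (Ici t₀ ×ˢ (univ : Set K)))
    (hdecay : ∀ t : ℝ, t₀ ≤ t → ∀ v : K,
      s (t, v) = (⨆ w : K, s (t, w)) → 0 < s (t, v) → s' (t, v) ≤ -c * s (t, v)) :
    ∀ t : ℝ, t₀ ≤ t →
      max 0 (⨆ w : K, s (t, w)) ≤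
        Real.exp (-c * (t - t₀)) * max 0 (⨆ w : K, s (t₀, w)) := by
  have hcont : ∀ v : K, ContinuousOn (fun τ : ℝ => s (τ, v)) (Ici t₀) :=
    fun v t ht => (hds v t ht).continuousWithinAt
  have hbdd : ∀ t, t₀ ≤ t → BddAbove (range fun w : K => s (t, w)) := by
    intro t ht
    have : Continuous fun w : K => s (t, w) :=
      hs.comp_continuous (by fun_prop) (fun w => ⟨ht, mem_univ _⟩)
    exact (isCompact_range this).bddAbove
  set M := max 0 (⨆ w : K, s (t₀, w)) with hM
  have hM0 : 0 ≤ M := le_max_left _ _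
  intro T hT
  have key : ∀ ε : ℝ, 0 < ε → ∀ v : K,
      s (T, v) ≤ Real.exp (-(c - ε) * (T - t₀)) * (M + ε) := by
    intro ε hε
    set B : ℝ → ℝ := fun t => Real.exp (-(c - ε) * (t - t₀)) * (M + ε) with hB
    have hBpos : ∀ t, 0 < B t := fun t => by positivity
    have hBc : Continuous B := by fun_prop
    have hBd : ∀ t, HasDerivAt B (-(c - ε) * B t) t := by
      intro t
      have h1 : HasDerivAt (fun t : ℝ => -(c - ε) * (t - t₀)) (-(c - ε) * 1) t :=
        ((hasDerivAt_id t).sub_const t₀).const_mul _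
      have h2 := h1.exp.mul_const (M + ε)
      refine h2.congr_deriv ?_
      change _ = -(c - ε) * (Real.exp (-(c - ε) * (t - t₀)) * (M + ε))
      ring
    by_contra! hcon
    obtain ⟨v₀, hv₀⟩ := hcon
    let A : Set (ℝ × K) := (Icc t₀ T ×ˢ univ) ∩ (fun p => s p - B p.1) ⁻¹' (Ici 0)
    have hAcl : IsClosed A := by
      apply ContinuousOn.preimage_isClosed_of_isClosed _ (isClosed_Icc.prod isClosed_univ)
        isClosed_Ici
      exact (hs.mono (prod_mono Icc_subset_Ici_self subset_rfl)).sub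
        (hBc.comp continuous_fst).continuousOn
    have hAc : IsCompact A :=
      (isCompact_Icc.prod isCompact_univ).of_isClosed_subset hAcl inter_subset_left
    have hAne : A.Nonempty := ⟨(T, v₀), ⟨⟨hT, le_rfl⟩, mem_univ _⟩, by
      simp only [mem_preimage, mem_Ici, hB]; linarith⟩
    obtain ⟨⟨t₁, v₁⟩, ⟨⟨ht₁, -⟩, hge⟩, hmin⟩ :=
      hAc.exists_isMinOn hAne continuous_fst.continuousOn
    simp only [mem_preimage, mem_Ici, sub_nonneg] at hge ht₁
    have hlt : ∀ t ∈ Ico t₀ t₁, ∀ v, s (t, v) < B t := by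
      intro t ht v
      by_contra! h
      have := hmin (a := (t, v)) ⟨⟨⟨ht.1, ht.2.le.trans ht₁.2⟩, mem_univ _⟩, by
        simpa using h⟩
      simp only [mem_ofPred_eq] at this
      exact absurd ht.2 (not_lt.2 this)
    have h01 : t₀ < t₁ := by
      refine lt_of_le_of_ne ht₁.1 ?_
      rintro rfl
      have h1 := le_ciSup (hbdd t₀ le_rfl) v₁
      have h2 : (⨆ w : K, s (t₀, w)) ≤ M := le_max_right _ _
      have h3 : B t₀ = M + ε := by simp [hB]
      linarith
    have hev : ∀ᶠ t in nhdsWithin t₁ (Iio t₁), t ∈ Ioo t₀ t₁ := Ioo_mem_nhdsLT h01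
    have hda : ∀ v, HasDerivAt (fun τ : ℝ => s (τ, v)) (s' (t₁, v)) t₁ :=
      fun v => (hds v t₁ h01.le).hasDerivAt (Ici_mem_nhds h01)
    have hle : ∀ v, s (t₁, v) ≤ B t₁ := by
      intro v
      refine le_of_tendsto_of_tendsto
        ((hda v).continuousAt.tendsto.mono_left nhdsWithin_le_nhds)
        (hBc.continuousAt.tendsto.mono_left (nhdsWithin_le_nhds (s := Iio t₁))) ?_
      filter_upwards [hev] with t ht
      exact (hlt t ⟨ht.1.le, ht.2⟩ v).le
    have heq : s (t₁, v₁) = B t₁ := le_antisymm (hle v₁) hge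
    have hsup : s (t₁, v₁) = ⨆ w : K, s (t₁, w) :=
      le_antisymm (le_ciSup (hbdd t₁ h01.le) v₁) (ciSup_le fun w => heq ▸ hle w)
    have hd := hdecay t₁ h01.le v₁ hsup (heq ▸ hBpos t₁)
    have hneg : s' (t₁, v₁) - -(c - ε) * B t₁ < 0 := by
      rw [heq] at hd
      nlinarith [mul_pos hε (hBpos t₁)]
    have hsl := ((hda v₁).sub (hBd t₁)).tendsto_slope.eventually_lt_const hneg
    have hsl' := hsl.filter_mono (nhdsWithin_mono (s := Iio t₁) t₁ (fun x (hx : x < t₁) => hx.ne))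
    obtain ⟨t, h1, h2⟩ := (hsl'.and hev).exists
    rw [slope_def_field] at h1
    simp only [Pi.sub_apply] at h1
    have h3 := hlt t ⟨h2.1.le, h2.2⟩ v₁
    have h4 := h2.2
    have := div_nonneg_of_nonpos
      (show s (t, v₁) - B t - (s (t₁, v₁) - B t₁) ≤ 0 by linarith)
      (show t - t₁ ≤ 0 by linarith)
    linarith
  refine max_le (by positivity) (ciSup_le fun v => ?_)
  have hcf : Continuous fun ε : ℝ => Real.exp (-(c - ε) * (T - t₀)) * (M + ε) := by fun_prop
  have hlim := (hcf.tendsto 0).mono_left (nhdsWithin_le_nhds (s := Ioi 0))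
  simp only [sub_zero, add_zero] at hlim
  refine ge_of_tendsto hlim ?_
  filter_upwards [self_mem_nhdsWithin] with ε hε
  exact key ε hε v
end
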